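/- Let Ω ⊆ ℝⁿ be a bounded open set and E ⊆ ℝⁿ a measurable set such that ∂⁻E ∩ Ω ≠ ∅ and Dim̄_M(∂⁻E,Ω) ≥ n−1. Then the fractal dimension relative to the fractional perimeter is bounded by the upper Minkowski dimension: n − sup{s ∈ (0,1) : P_s^L(E,Ω) < ∞} ≤ Dim̄_M(∂⁻E,Ω). -/

import Mathlib

open MeasureTheory Metric Set Filter Bornology
open scoped ENNReal Topology

/-- The fractional kernel `|x-y|^{-(n+s)}` as an extended nonnegative real. -/
noncomputable def fracKer (n : ℕ) (s : ℝ) (x y : EuclideanSpace ℝ (Fin n)) : ℝ≥0∞ :=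
  ENNReal.ofReal (‖x - y‖ ^ (-((n : ℝ) + s)))

/-- The interaction `L_s(A,B) = ∫_A ∫_B |x-y|^{-(n+s)} dy dx`. -/
noncomputable def interL (n : ℕ) (s : ℝ) (A B : Set (EuclideanSpace ℝ (Fin n))) : ℝ≥0∞ :=
  ∫⁻ x in A, ∫⁻ y in B, fracKer n s x y

/-- The local part of the `s`-fractional perimeter of `E` in `Ω`. -/
noncomputable def perL (n : ℕ) (s : ℝ) (E Ω : Set (EuclideanSpace ℝ (Fin n))) : ℝ≥0∞ :=
  interL n s (E ∩ Ω) (Eᶜ ∩ Ω)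

/-- The nonlocal part of the `s`-fractional perimeter of `E` in `Ω`. -/
noncomputable def perNL (n : ℕ) (s : ℝ) (E Ω : Set (EuclideanSpace ℝ (Fin n))) : ℝ≥0∞ :=
  interL n s (E ∩ Ω) (Eᶜ \ Ω) + interL n s (E \ Ω) (Eᶜ ∩ Ω)

/-- The `s`-fractional perimeter of `E` in `Ω`. -/
noncomputable def per (n : ℕ) (s : ℝ) (E Ω : Set (EuclideanSpace ℝ (Fin n))) : ℝ≥0∞ :=
  interL n s (E ∩ Ω) (Eᶜ ∩ Ω) + interL n s (E ∩ Ω) (Eᶜ \ Ω) + interL n s (E \ Ω) (Eᶜ ∩ Ω)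

/-- The global `s`-fractional perimeter `P_s(E) = L_s(E, Eᶜ)`. -/
noncomputable def perG (n : ℕ) (s : ℝ) (E : Set (EuclideanSpace ℝ (Fin n))) : ℝ≥0∞ :=
  interL n s E Eᶜ

/-- The measure theoretic boundary `∂⁻E`. Note `volume (ball x r) = ω_n rⁿ`. -/
def mtb (n : ℕ) (E : Set (EuclideanSpace ℝ (Fin n))) : Set (EuclideanSpace ℝ (Fin n)) :=
  {x | ∀ r > (0 : ℝ), 0 < volume (E ∩ ball x r) ∧ volume (E ∩ ball x r) < volume (ball x r)}

/-- `E` has locally finite `s`-perimeter: finite `s`-perimeter in every bounded open set. -/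
def locFinPer (n : ℕ) (s : ℝ) (E : Set (EuclideanSpace ℝ (Fin n))) : Prop :=
  ∀ Ω : Set (EuclideanSpace ℝ (Fin n)), IsOpen Ω → IsBounded Ω → per n s E Ω < ⊤

/-- The closed `ρ`-neighborhood of `Γ` relative to `Ω`: `{x ∈ Ω : dist(x,Γ) ≤ ρ}`. -/
def clNbd (n : ℕ) (ρ : ℝ) (Γ Ω : Set (EuclideanSpace ℝ (Fin n))) :
    Set (EuclideanSpace ℝ (Fin n)) :=
  {x ∈ Ω | Metric.infDist x Γ ≤ ρ}

/-- The upper `r`-dimensional Minkowski content of `Γ` relative to `Ω`: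
`limsup_{ρ→0⁺} |N̄_ρ^Ω(Γ)| / ρ^{n-r}`. -/
noncomputable def upMinkContent (n : ℕ) (r : ℝ) (Γ Ω : Set (EuclideanSpace ℝ (Fin n))) : ℝ≥0∞ :=
  Filter.limsup (fun ρ : ℝ => volume (clNbd n ρ Γ Ω) / ENNReal.ofReal (ρ ^ ((n : ℝ) - r)))
    (𝓝[>] 0)

/-- The upper Minkowski dimension of `Γ` relative to `Ω`:
`sup {r ∈ [0,n] : M̄^r(Γ,Ω) = ∞}`. -/
noncomputable def upMinkDim (n : ℕ) (Γ Ω : Set (EuclideanSpace ℝ (Fin n))) : ℝ :=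
  sSup {r : ℝ | r ∈ Set.Icc (0 : ℝ) n ∧ upMinkContent n r Γ Ω = ⊤}

lemma aux_inf {n : ℕ} (E : Set (EuclideanSpace ℝ (Fin n))) (hE : MeasurableSet E) :
    ∃ U V : Set (EuclideanSpace ℝ (Fin n)), volume (U ∩ E) = 0 ∧ volume (V ∩ Eᶜ) = 0 ∧
      ∀ x y, x ∉ U → y ∉ V → infDist x (mtb n E) ≤ dist x y := by
  have hop : ∀ A : Set (EuclideanSpace ℝ (Fin n)),
      IsOpen {x | ∃ r > (0 : ℝ), volume (A ∩ ball x r) = 0} := by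
    intro A
    rw [Metric.isOpen_iff]
    rintro x ⟨r, hr, h⟩
    refine ⟨r / 2, by positivity, fun y hy => ⟨r / 2, by positivity, ?_⟩⟩
    refine measure_mono_null (inter_subset_inter_right A (ball_subset_ball' ?_)) h
    have := mem_ball.1 hy
    linarith
  have hnull : ∀ A : Set (EuclideanSpace ℝ (Fin n)),
      volume ({x | ∃ r > (0 : ℝ), volume (A ∩ ball x r) = 0} ∩ A) = 0 := by
    intro A
    refine measure_null_of_locally_null _ ?_
    rintro x ⟨⟨r, hr, h⟩, hxA⟩
    refine ⟨A ∩ ball x r, ?_, h⟩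
    rw [mem_nhdsWithin]
    exact ⟨ball x r, isOpen_ball, mem_ball_self hr, fun z hz => ⟨hz.2.2, hz.1⟩⟩
  refine ⟨_, _, hnull E, hnull Eᶜ, ?_⟩
  intro x y hx hy
  have hballs : ∀ z : EuclideanSpace ℝ (Fin n), ∀ r > (0 : ℝ),
      volume (E ∩ ball z r) + volume (Eᶜ ∩ ball z r) = volume (ball z r) := by
    intro z r hr
    have := measure_inter_add_diff (μ := volume) (ball z r) hE
    rw [← this, inter_comm, diff_eq, inter_comm Eᶜ]
  have key : (segment ℝ x y ∩ mtb n E).Nonempty := by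
    by_contra hcon
    rw [not_nonempty_iff_eq_empty] at hcon
    have hcov : ∀ z, z ∉ mtb n E → z ∈ {x | ∃ r > (0 : ℝ), volume (E ∩ ball x r) = 0} ∪
        {x | ∃ r > (0 : ℝ), volume (Eᶜ ∩ ball x r) = 0} := by
      intro z hz
      simp only [mtb, mem_setOf_eq, not_forall] at hz
      obtain ⟨r, hr, h⟩ := hz
      by_cases h0 : volume (E ∩ ball z r) = 0
      · exact Or.inl ⟨r, hr, h0⟩
      · right
        refine ⟨r, hr, ?_⟩
        have h1 : volume (ball z r) ≤ volume (E ∩ ball z r) := by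
          by_contra h2
          exact h ⟨pos_iff_ne_zero.2 h0, not_le.1 h2⟩
        by_contra h3
        have hfin : volume (E ∩ ball z r) ≠ ⊤ :=
          ((measure_mono inter_subset_right).trans_lt measure_ball_lt_top).ne
        have h4 := ENNReal.lt_add_right hfin h3
        rw [hballs z r hr] at h4
        exact absurd h1 (not_le.2 h4)
    have hseg : ∀ z ∈ segment ℝ x y, z ∉ mtb n E := fun z hz hz' => by
      have : z ∈ segment ℝ x y ∩ mtb n E := ⟨hz, hz'⟩
      rw [hcon] at this
      exact this
    have hpre : IsPreconnected (segment ℝ x y) := (convex_segment x y).isPreconnected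
    obtain ⟨z, hz, ⟨r1, hr1, h1⟩, ⟨r2, hr2, h2⟩⟩ := hpre _ _ (hop E) (hop Eᶜ)
      (fun z hz => hcov z (hseg z hz))
      ⟨y, right_mem_segment ℝ x y, (hcov y (hseg y (right_mem_segment ℝ x y))).resolve_right hy⟩
      ⟨x, left_mem_segment ℝ x y, (hcov x (hseg x (left_mem_segment ℝ x y))).resolve_left hx⟩
    have hm : 0 < min r1 r2 := lt_min hr1 hr2
    have h1' := measure_mono_null
      (inter_subset_inter_right E (ball_subset_ball (x := z) (min_le_left r1 r2))) h1
    have h2' := measure_mono_null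
      (inter_subset_inter_right Eᶜ (ball_subset_ball (x := z) (min_le_right r1 r2))) h2
    have := hballs z _ hm
    rw [h1', h2', add_zero] at this
    exact (measure_ball_pos volume z hm).ne this
  obtain ⟨z, hz, hzm⟩ := key
  refine (infDist_le_dist_of_mem hzm).trans ?_
  have := dist_add_dist_of_mem_segment hz
  have := dist_nonneg (x := z) (y := y)
  linarith

lemma aux_ker {n : ℕ} {s a : ℝ} (hs : 0 < s) (ha : 0 < a) (x y : EuclideanSpace ℝ (Fin n))
    (hxy : x ≠ y) :
    fracKer n s x y ≤ ENNReal.ofReal (a ^ (-((n : ℝ) + s))) +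
      ∑' k : ℕ, (if dist x y ≤ a * (1 / 2) ^ k then
        ENNReal.ofReal ((a * (1 / 2) ^ k / 2) ^ (-((n : ℝ) + s))) else 0) := by
  have hd : 0 < dist x y := dist_pos.2 hxy
  have hneg : -((n : ℝ) + s) ≤ 0 := by
    have : (0 : ℝ) ≤ n := n.cast_nonneg
    linarith
  unfold fracKer
  rw [← dist_eq_norm]
  rcases le_total a (dist x y) with h | h
  · exact le_add_right (ENNReal.ofReal_le_ofReal (Real.rpow_le_rpow_of_nonpos ha h hneg))
  · obtain ⟨k, hk1, hk2⟩ := exists_nat_pow_near_of_lt_one (x := dist x y / a) (y := (1 / 2 : ℝ))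
      (by positivity) ((div_le_one ha).2 h) (by norm_num) (by norm_num)
    rw [lt_div_iff₀ ha] at hk1
    rw [div_le_iff₀ ha] at hk2
    refine le_add_left (le_trans ?_ (ENNReal.le_tsum k))
    rw [if_pos (by linarith)]
    refine ENNReal.ofReal_le_ofReal (Real.rpow_le_rpow_of_nonpos (by positivity) ?_ hneg)
    rw [pow_succ] at hk1
    linarith

lemma aux_per {n : ℕ} {Ω E : Set (EuclideanSpace ℝ (Fin n))} {s t : ℝ}
    (hΩo : IsOpen Ω) (hΩb : IsBounded Ω) (hE : MeasurableSet E) (hs : 0 < s) (hst : s < t)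
    (hc : upMinkContent n ((n : ℝ) - t) (mtb n E) Ω ≠ ⊤) : perL n s E Ω < ⊤ := by
  obtain ⟨C, hC1, hC2⟩ := exists_between (lt_top_iff_ne_top.2 hc)
  have hev := eventually_lt_of_limsup_lt hC1
  rw [Filter.Eventually, mem_nhdsGT_iff_exists_Ioo_subset] at hev
  obtain ⟨ρ0, hρ0, hsub⟩ := hev
  have hρ0 : 0 < ρ0 := hρ0
  have hN : ∀ ρ, 0 < ρ → ρ < ρ0 →
      volume (clNbd n ρ (mtb n E) Ω) ≤ C * ENNReal.ofReal (ρ ^ t) := by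
    intro ρ h1 h2
    have h3 := hsub ⟨h1, h2⟩
    simp only [mem_setOf_eq, sub_sub_cancel] at h3
    have hp : 0 < ρ ^ t := Real.rpow_pos_of_pos h1 t
    exact (ENNReal.div_le_iff (by simpa using hp) ENNReal.ofReal_ne_top).1 h3.le
  set a := ρ0 / 2 with ha_def
  have ha : 0 < a := by positivity
  set ρ : ℕ → ℝ := fun k => a * (1 / 2) ^ k with hρ_def
  have hρpos : ∀ k, 0 < ρ k := fun k => by positivity
  have hρlt : ∀ k, ρ k < ρ0 := fun k => by
    have : ((1 : ℝ) / 2) ^ k ≤ 1 := pow_le_one₀ (by norm_num) (by norm_num)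
    have : ρ k ≤ a := by simpa [hρ_def] using mul_le_mul_of_nonneg_left this ha.le
    linarith
  set c : ℕ → ℝ≥0∞ := fun k => ENNReal.ofReal ((ρ k / 2) ^ (-((n : ℝ) + s))) with hc_def
  set K : ℝ≥0∞ := ENNReal.ofReal (a ^ (-((n : ℝ) + s))) with hK_def
  set ω : ℝ≥0∞ := volume (ball (0 : EuclideanSpace ℝ (Fin n)) 1) with hω
  have hωt : ω < ⊤ := measure_ball_lt_top
  have hvΩ : volume Ω < ⊤ := hΩb.measure_lt_top
  have hvol : ∀ (x : EuclideanSpace ℝ (Fin n)) k,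
      volume (closedBall x (ρ k)) = ENNReal.ofReal (ρ k ^ n) * ω := by
    intro x k
    rw [Measure.addHaar_closedBall volume x (hρpos k).le]
    simp [hω]
  have hNm : ∀ k, MeasurableSet (clNbd n (ρ k) (mtb n E) Ω) := fun k =>
    hΩo.measurableSet.inter (measurableSet_le (continuous_infDist_pt _).measurable
      measurable_const)
  obtain ⟨U, V, hU, hV, hUV⟩ := aux_inf E hE
  have hxae : ∀ᵐ x ∂(volume.restrict (E ∩ Ω)), x ∉ U ∧ x ∈ E ∩ Ω := by
    have h1 : ∀ᵐ x ∂volume, x ∉ U ∩ E := measure_eq_zero_iff_ae_notMem.1 hU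
    filter_upwards [ae_restrict_of_ae h1, ae_restrict_mem (hE.inter hΩo.measurableSet)]
      with x h2 h3
    exact ⟨fun h => h2 ⟨h, h3.1⟩, h3⟩
  have hyae : ∀ᵐ y ∂(volume.restrict (Eᶜ ∩ Ω)), y ∉ V ∧ y ∈ Eᶜ ∩ Ω := by
    have h1 : ∀ᵐ x ∂volume, x ∉ V ∩ Eᶜ := measure_eq_zero_iff_ae_notMem.1 hV
    filter_upwards [ae_restrict_of_ae h1, ae_restrict_mem (hE.compl.inter hΩo.measurableSet)]
      with x h2 h3
    exact ⟨fun h => h2 ⟨h, h3.1⟩, h3⟩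
  have hinner : ∀ x, x ∉ U ∧ x ∈ E ∩ Ω → ∫⁻ y in Eᶜ ∩ Ω, fracKer n s x y ≤
      K * volume Ω + ∑' k, (clNbd n (ρ k) (mtb n E) Ω).indicator
        (fun _ => c k * (ENNReal.ofReal (ρ k ^ n) * ω)) x := by
    rintro x ⟨hxU, hxE, hxΩ⟩
    calc ∫⁻ y in Eᶜ ∩ Ω, fracKer n s x y
        ≤ ∫⁻ y in Eᶜ ∩ Ω, (K + ∑' k, (closedBall x (ρ k)).indicator (fun _ =>
            (clNbd n (ρ k) (mtb n E) Ω).indicator (fun _ => c k) x) y) := by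
          refine lintegral_mono_ae ?_
          filter_upwards [hyae] with y hy
          have hne : x ≠ y := fun h => hy.2.1 (h ▸ hxE)
          refine (aux_ker hs ha x y hne).trans ?_
          refine add_le_add le_rfl (ENNReal.tsum_le_tsum fun k => ?_)
          split_ifs with h
          · have h1 : y ∈ closedBall x (ρ k) := by rw [mem_closedBall, dist_comm]; exact h
            have h2 : x ∈ clNbd n (ρ k) (mtb n E) Ω := ⟨hxΩ, (hUV x y hxU hy.1).trans h⟩
            rw [indicator_of_mem h1, indicator_of_mem h2]
          · exact zero_le
      _ ≤ K * volume Ω + ∑' k, (clNbd n (ρ k) (mtb n E) Ω).indicator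
        (fun _ => c k * (ENNReal.ofReal (ρ k ^ n) * ω)) x := by
          rw [lintegral_add_left measurable_const, lintegral_tsum (fun k =>
            (measurable_const.indicator measurableSet_closedBall).aemeasurable)]
          refine add_le_add ?_ (ENNReal.tsum_le_tsum fun k => ?_)
          · rw [lintegral_const, Measure.restrict_apply_univ]
            gcongr
            exact inter_subset_right
          · rw [lintegral_indicator_const measurableSet_closedBall]
            by_cases h2 : x ∈ clNbd n (ρ k) (mtb n E) Ω
            · rw [indicator_of_mem h2, indicator_of_mem h2, ← hvol x k]
              gcongr
              exact Measure.restrict_le_self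
            · rw [indicator_of_notMem h2]; simp
  have hmain : perL n s E Ω ≤ K * volume Ω * volume Ω +
      ∑' k, c k * (ENNReal.ofReal (ρ k ^ n) * ω) * (C * ENNReal.ofReal (ρ k ^ t)) := by
    calc perL n s E Ω ≤ ∫⁻ x in E ∩ Ω, (K * volume Ω + ∑' k,
          (clNbd n (ρ k) (mtb n E) Ω).indicator
            (fun _ => c k * (ENNReal.ofReal (ρ k ^ n) * ω)) x) := by
          unfold perL interL
          refine lintegral_mono_ae ?_
          filter_upwards [hxae] with x hx using hinner x hx
      _ ≤ _ := by
          rw [lintegral_add_left measurable_const, lintegral_tsum (fun k =>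
            (measurable_const.indicator (hNm k)).aemeasurable)]
          refine add_le_add ?_ (ENNReal.tsum_le_tsum fun k => ?_)
          · rw [lintegral_const, Measure.restrict_apply_univ]
            gcongr
            exact inter_subset_right
          · rw [lintegral_indicator_const (hNm k)]
            gcongr
            exact (Measure.restrict_apply_le _ _).trans (hN _ (hρpos k) (hρlt k))
  refine hmain.trans_lt ?_
  refine ENNReal.add_lt_top.2 ⟨ENNReal.mul_lt_top
    (ENNReal.mul_lt_top ENNReal.ofReal_lt_top hvΩ) hvΩ, ?_⟩
  set q : ℝ := (1 / 2 : ℝ) ^ (t - s) with hq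
  have hq0 : 0 ≤ q := by positivity
  have hq1 : q < 1 := Real.rpow_lt_one (by norm_num) (by norm_num) (by linarith)
  set M : ℝ := (1 / 2 : ℝ) ^ (-((n : ℝ) + s)) * a ^ (t - s) with hM
  have hterm : ∀ k, c k * (ENNReal.ofReal (ρ k ^ n) * ω) * (C * ENNReal.ofReal (ρ k ^ t)) =
      (C * ω) * ENNReal.ofReal (M * q ^ k) := by
    intro k
    have hr : (ρ k / 2) ^ (-((n : ℝ) + s)) * ρ k ^ n * ρ k ^ t = M * q ^ k := by
      have h1 : (ρ k / 2) ^ (-((n : ℝ) + s)) =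
          (1 / 2 : ℝ) ^ (-((n : ℝ) + s)) * ρ k ^ (-((n : ℝ) + s)) := by
        rw [← Real.mul_rpow (by norm_num) (hρpos k).le]
        congr 1
        ring
      have h2 : ρ k ^ (-((n : ℝ) + s)) * ρ k ^ n * ρ k ^ t = ρ k ^ (t - s) := by
        rw [← Real.rpow_natCast, ← Real.rpow_add (hρpos k), ← Real.rpow_add (hρpos k)]
        congr 1
        ring
      have h3 : ρ k ^ (t - s) = a ^ (t - s) * q ^ k := by
        simp only [hρ_def, hq]
        rw [Real.mul_rpow ha.le (by positivity), ← Real.rpow_natCast, ← Real.rpow_natCast,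
          ← Real.rpow_mul (by norm_num), ← Real.rpow_mul (by norm_num), mul_comm (k : ℝ)]
      rw [h1, hM, mul_assoc _ (a ^ (t - s)), ← h3, ← h2]
      ring
    rw [← hr, ENNReal.ofReal_mul (by have := hρpos k; positivity),
      ENNReal.ofReal_mul (by have := hρpos k; positivity)]
    simp only [hc_def]
    ring
  simp_rw [hterm]
  rw [ENNReal.tsum_mul_left]
  refine ENNReal.mul_lt_top (ENNReal.mul_lt_top hC2 hωt) ?_
  exact lt_top_iff_ne_top.2 ((summable_geometric_of_lt_one hq0 hq1).mul_left M).tsum_ofReal_ne_top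

/-- For a bounded open set `Ω` and a measurable set `E` with
`∂⁻E ∩ Ω ≠ ∅` and `Dim̄_M(∂⁻E,Ω) ≥ n-1`, the fractal dimension relative to the
fractional perimeter is bounded above by the upper Minkowski dimension. -/
theorem fracDim_le_upMinkDim (n : ℕ) (hn : 1 ≤ n) (Ω : Set (EuclideanSpace ℝ (Fin n)))
    (hΩo : IsOpen Ω) (hΩb : IsBounded Ω) (E : Set (EuclideanSpace ℝ (Fin n)))
    (hE : MeasurableSet E) (hne : (mtb n E ∩ Ω).Nonempty)
    (hdim : (n : ℝ) - 1 ≤ upMinkDim n (mtb n E) Ω) :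
    (n : ℝ) - sSup {s : ℝ | s ∈ Set.Ioo (0 : ℝ) 1 ∧ perL n s E Ω < ⊤} ≤
      upMinkDim n (mtb n E) Ω := by
  set D := upMinkDim n (mtb n E) Ω with hD
  have hnn : (1 : ℝ) ≤ n := by exact_mod_cast hn
  have h0 : 0 ≤ sSup {s : ℝ | s ∈ Set.Ioo (0 : ℝ) 1 ∧ perL n s E Ω < ⊤} :=
    Real.sSup_nonneg fun s hs => hs.1.1.le
  suffices h : (n : ℝ) - D ≤ sSup {s : ℝ | s ∈ Set.Ioo (0 : ℝ) 1 ∧ perL n s E Ω < ⊤} by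
    linarith
  refine le_of_forall_lt_imp_le_of_dense fun s hs => ?_
  rcases le_or_gt s 0 with hs0 | hs0
  · exact hs0.trans h0
  refine le_csSup ⟨1, fun x hx => hx.1.2.le⟩ ⟨⟨hs0, by linarith⟩, ?_⟩
  obtain ⟨t, hst, htD⟩ := exists_between hs
  refine aux_per hΩo hΩb hE hs0 hst fun htop => ?_
  have : (n : ℝ) - t ≤ D :=
    le_csSup (s := {r : ℝ | r ∈ Set.Icc (0 : ℝ) n ∧ upMinkContent n r (mtb n E) Ω = ⊤})
      ⟨n, fun r hr => hr.1.2⟩ ⟨⟨by linarith, by linarith⟩, htop⟩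
  linarith
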